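/- Let T₁, T₂ : M → A be O-operators on an associative conformal algebra A with respect to a conformal bimodule M, and suppose T₁ and T₂ are bijective (so their inverses are again ℂ[∂]-module homomorphisms). Then T₁ and T₂ are compatible, i.e., T₁ + T₂ is again an O-operator, if and only if N = T₁ ∘ T₂⁻¹ : A → A is a Nijenhuis operator on A. -/

import Mathlib

open Polynomial

noncomputable section

/-!  Framework for associative conformal algebras over `ℂ[∂]`.

A `ℂ[∂]`-module is modelled as a module over `ℂ[X]` (with the variable `X`
playing the role of `∂`), together with a compatible `ℂ`-action.  A polynomial
`Σᵢ λ^i cᵢ` in a formal variable `λ` with coefficients in a module `V` is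
recorded by its finitely supported family of coefficients `ℕ →₀ V`.  Identities
between such polynomials are stated through their evaluations at every
`lam : ℂ`; over the infinite field `ℂ` this is equivalent to the corresponding
polynomial identities. -/

/-- Evaluation at `lam : ℂ` of a `V`-valued polynomial given by its coefficients. -/
def cev {V : Type*} [AddCommMonoid V] [Module ℂ V] (lam : ℂ) (p : ℕ →₀ V) : V :=
  p.sum fun i c => lam ^ i • c

/-- Substitution `μ ↦ -λ - ∂` in the polynomial `μ ↦ Σᵢ μ^i cᵢ`, where `∂ = X`
acts through the `ℂ[∂]`-module structure. -/
def csub {V : Type*} [AddCommMonoid V] [Module ℂ[X] V] (lam : ℂ) (p : ℕ →₀ V) : V :=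
  p.sum fun i c => ((-(C lam) - X) ^ i : ℂ[X]) • c

/-- A `ℂ`-bilinear conformal sesquilinear λ-product `A × B → M[λ]`, recorded by
the coefficient family `coeff a b : ℕ →₀ M` of the polynomial `a_λ b`. -/
structure ConfBilin (A B M : Type*)
    [AddCommGroup A] [Module ℂ A] [Module ℂ[X] A]
    [AddCommGroup B] [Module ℂ B] [Module ℂ[X] B]
    [AddCommGroup M] [Module ℂ M] [Module ℂ[X] M] where
  coeff : A → B → ℕ →₀ M
  add_left : ∀ a a' b, coeff (a + a') b = coeff a b + coeff a' b
  smul_left : ∀ (c : ℂ) a b, coeff (c • a) b = c • coeff a b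
  add_right : ∀ a b b', coeff a (b + b') = coeff a b + coeff a b'
  smul_right : ∀ (c : ℂ) a b, coeff a (c • b) = c • coeff a b
  /-- `(∂a)_λ b = -λ (a_λ b)` -/
  sesq_left : ∀ (lam : ℂ) (a : A) (b : B),
    cev lam (coeff ((X : ℂ[X]) • a) b) = (-lam) • cev lam (coeff a b)
  /-- `a_λ (∂b) = (∂ + λ) (a_λ b)` -/
  sesq_right : ∀ (lam : ℂ) (a : A) (b : B),
    cev lam (coeff a ((X : ℂ[X]) • b)) =
      (X : ℂ[X]) • cev lam (coeff a b) + lam • cev lam (coeff a b)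

namespace ConfBilin

variable {A B M : Type*}
  [AddCommGroup A] [Module ℂ A] [Module ℂ[X] A]
  [AddCommGroup B] [Module ℂ B] [Module ℂ[X] B]
  [AddCommGroup M] [Module ℂ M] [Module ℂ[X] M]

/-- `a_lam b` : the λ-product evaluated at `lam : ℂ`. -/
def mul (f : ConfBilin A B M) (lam : ℂ) (a : A) (b : B) : M := cev lam (f.coeff a b)

/-- `a_{-λ-∂} b` : the λ-product with `-λ-∂` substituted for the variable. -/
def mulNeg (f : ConfBilin A B M) (lam : ℂ) (a : A) (b : B) : M := csub lam (f.coeff a b)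

end ConfBilin

/-- An associative conformal algebra structure on the `ℂ[∂]`-module `A`. -/
structure AssocConfAlg (A : Type*)
    [AddCommGroup A] [Module ℂ A] [Module ℂ[X] A] extends ConfBilin A A A where
  /-- `(a_λ b)_{λ+μ} c = a_λ (b_μ c)` -/
  assoc : ∀ (lam mu : ℂ) (a b c : A),
    toConfBilin.mul (lam + mu) (toConfBilin.mul lam a b) c =
      toConfBilin.mul lam a (toConfBilin.mul mu b c)

namespace AssocConfAlg

variable {A : Type*} [AddCommGroup A] [Module ℂ A] [Module ℂ[X] A]

def mul (θ : AssocConfAlg A) : ℂ → A → A → A := θ.toConfBilin.mul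

def mulNeg (θ : AssocConfAlg A) : ℂ → A → A → A := θ.toConfBilin.mulNeg

end AssocConfAlg

/-- A conformal bimodule `M` over the associative conformal algebra `(A, θ)`,
with left action `l` and right action `r`. -/
structure ConfBimod {A : Type*} [AddCommGroup A] [Module ℂ A] [Module ℂ[X] A]
    (θ : AssocConfAlg A) (M : Type*)
    [AddCommGroup M] [Module ℂ M] [Module ℂ[X] M] where
  l : ConfBilin A M M
  r : ConfBilin M A M
  /-- `(a_λ b)_{λ+μ} m = a_λ (b_μ m)` -/
  assoc_ll : ∀ (lam mu : ℂ) (a b : A) (m : M),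
    l.mul (lam + mu) (θ.mul lam a b) m = l.mul lam a (l.mul mu b m)
  /-- `(m_λ a)_{λ+μ} b = m_λ (a_μ b)` -/
  assoc_rr : ∀ (lam mu : ℂ) (m : M) (a b : A),
    r.mul (lam + mu) (r.mul lam m a) b = r.mul lam m (θ.mul mu a b)
  /-- `(a_λ m)_{λ+μ} b = a_λ (m_μ b)` -/
  assoc_lr : ∀ (lam mu : ℂ) (a : A) (m : M) (b : A),
    r.mul (lam + mu) (l.mul lam a m) b = l.mul lam a (r.mul mu m b)

section Defs

variable {A M : Type*}
  [AddCommGroup A] [Module ℂ A] [Module ℂ[X] A]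
  [AddCommGroup M] [Module ℂ M] [Module ℂ[X] M]

/-- `T : M → A` is an `𝒪`-operator on `(A, θ)` with respect to the conformal
bimodule `ρ` : `T(m)_λ T(n) = T (T(m)_λ n + m_λ T(n))`. -/
def IsOOperator {θ : AssocConfAlg A} (ρ : ConfBimod θ M) (T : M → A) : Prop :=
  ∀ (lam : ℂ) (m n : M),
    θ.mul lam (T m) (T n) = T (ρ.l.mul lam (T m) n + ρ.r.mul lam m (T n))

/-- `N : A → A` is a Nijenhuis operator :
`N(a)_λ N(b) = N (N(a)_λ b + a_λ N(b) - N(a_λ b))`. -/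
def IsNijenhuis (θ : AssocConfAlg A) (N : A → A) : Prop :=
  ∀ (lam : ℂ) (a b : A),
    θ.mul lam (N a) (N b) =
      N (θ.mul lam (N a) b + θ.mul lam a (N b) - N (θ.mul lam a b))

/-- `T : A → A` is a Rota-Baxter operator of weight `q`. -/
def IsRotaBaxterWt (θ : AssocConfAlg A) (q : ℂ) (T : A → A) : Prop :=
  ∀ (lam : ℂ) (a b : A),
    θ.mul lam (T a) (T b) =
      T (θ.mul lam (T a) b + θ.mul lam a (T b) + q • θ.mul lam a b)

/-- The Hochschild 2-cocycle identity for an `M`-valued λ-bilinear map `ψ` on `A`. -/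
def IsTwoCocycleFun {θ : AssocConfAlg A} (ρ : ConfBimod θ M)
    (ψ : ℂ → A → A → M) : Prop :=
  ∀ (lam mu : ℂ) (a b c : A),
    ρ.l.mul lam a (ψ mu b c) - ψ (lam + mu) (θ.mul lam a b) c
      + ψ lam a (θ.mul mu b c) - ρ.r.mul (lam + mu) (ψ lam a b) c = 0

/-- `φ` is a 2-cocycle in `C²(A, M)`. -/
def IsTwoCocycle {θ : AssocConfAlg A} (ρ : ConfBimod θ M)
    (φ : ConfBilin A A M) : Prop :=
  IsTwoCocycleFun ρ φ.mul

/-- `T : M → A` is a `φ`-twisted Rota-Baxter operator :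
`T(m)_λ T(n) = T (T(m)_λ n + m_λ T(n) + φ_λ(T(m), T(n)))`. -/
def IsTwistedRB {θ : AssocConfAlg A} (ρ : ConfBimod θ M) (φ : ConfBilin A A M)
    (T : M → A) : Prop :=
  ∀ (lam : ℂ) (m n : M),
    θ.mul lam (T m) (T n) =
      T (ρ.l.mul lam (T m) n + ρ.r.mul lam m (T n) + φ.mul lam (T m) (T n))

/-- The λ-product of the semidirect product `A ⊕₀ M`. -/
def sdMul {θ : AssocConfAlg A} (ρ : ConfBimod θ M) (lam : ℂ) (x y : A × M) : A × M :=
  (θ.mul lam x.1 y.1, ρ.l.mul lam x.1 y.2 + ρ.r.mul lam x.2 y.1)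

/-- The λ-product of the twisted semidirect product `A ⊕_ψ M`. -/
def sdMulTw {θ : AssocConfAlg A} (ρ : ConfBimod θ M) (ψ : ℂ → A → A → M)
    (lam : ℂ) (x y : A × M) : A × M :=
  (θ.mul lam x.1 y.1, ρ.l.mul lam x.1 y.2 + ρ.r.mul lam x.2 y.1 + ψ lam x.1 y.1)

/-- The lift `T̂(a, m) = (T(m), 0)` of a map `T : M → A` to `A ⊕ M`. -/
def liftMap (T : M → A) (x : A × M) : A × M := (T x.2, 0)

/-- The λ-product `m ⋆_λ n = T(m)_λ n + m_λ T(n)` on `M` induced by an `𝒪`-operator. -/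
def oStar {θ : AssocConfAlg A} (ρ : ConfBimod θ M) (T : M → A)
    (lam : ℂ) (m n : M) : M :=
  ρ.l.mul lam (T m) n + ρ.r.mul lam m (T n)

/-- The left λ-action `m ·_λ a = T(m)_λ a - T(m_λ a)` of `M_ass` on `A`. -/
def oDotL {θ : AssocConfAlg A} (ρ : ConfBimod θ M) (T : M → A)
    (lam : ℂ) (m : M) (a : A) : A :=
  θ.mul lam (T m) a - T (ρ.r.mul lam m a)

/-- The right λ-action `a ·_λ m = a_λ T(m) - T(a_λ m)` of `M_ass` on `A`. -/
def oDotR {θ : AssocConfAlg A} (ρ : ConfBimod θ M) (T : M → A)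
    (lam : ℂ) (a : A) (m : M) : A :=
  θ.mul lam a (T m) - T (ρ.l.mul lam a m)

/-- `m ⋆^φ_λ n = T(m)_λ n + m_λ T(n) + φ_λ(T(m), T(n))`. -/
def twStar {θ : AssocConfAlg A} (ρ : ConfBimod θ M) (φ : ConfBilin A A M)
    (T : M → A) (lam : ℂ) (m n : M) : M :=
  ρ.l.mul lam (T m) n + ρ.r.mul lam m (T n) + φ.mul lam (T m) (T n)

/-- `m ·^φ_λ a = T(m)_λ a - T (m_λ a + φ_λ(T(m), a))`. -/
def twDotL {θ : AssocConfAlg A} (ρ : ConfBimod θ M) (φ : ConfBilin A A M)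
    (T : M → A) (lam : ℂ) (m : M) (a : A) : A :=
  θ.mul lam (T m) a - T (ρ.r.mul lam m a + φ.mul lam (T m) a)

/-- `a ·^φ_λ m = a_λ T(m) - T (a_λ m + φ_λ(a, T(m)))`. -/
def twDotR {θ : AssocConfAlg A} (ρ : ConfBimod θ M) (φ : ConfBilin A A M)
    (T : M → A) (lam : ℂ) (a : A) (m : M) : A :=
  θ.mul lam a (T m) - T (ρ.l.mul lam a m + φ.mul lam a (T m))

/-- The map `(a, m) ↦ (a, m - h(a))` on `A ⊕ M`. -/
def shiftMap (h : A → M) (p : A × M) : A × M := (p.1, p.2 - h p.1)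

/-- The deformed λ-product `a ∘^N_λ b = N(a)_λ b + a_λ N(b) - N(a_λ b)`. -/
def nijProd (θ : AssocConfAlg A) (N : A → A) (lam : ℂ) (a b : A) : A :=
  θ.mul lam (N a) b + θ.mul lam a (N b) - N (θ.mul lam a b)

end Defs

/-- A dendriform conformal algebra. -/
structure DendriformConfAlg (E : Type*)
    [AddCommGroup E] [Module ℂ E] [Module ℂ[X] E] where
  succ : ConfBilin E E E
  prec : ConfBilin E E E
  dend1 : ∀ (lam mu : ℂ) (a b c : E),
    succ.mul lam a (succ.mul mu b c) =
      succ.mul (lam + mu) (succ.mul lam a b + prec.mul lam a b) c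
  dend2 : ∀ (lam mu : ℂ) (a b c : E),
    prec.mul (lam + mu) (prec.mul lam a b) c =
      prec.mul lam a (succ.mul mu b c + prec.mul mu b c)
  dend3 : ∀ (lam mu : ℂ) (a b c : E),
    prec.mul (lam + mu) (succ.mul lam a b) c = succ.mul lam a (prec.mul mu b c)

/-- The product `a ∘_λ b = a ≻_λ b - b ≺_{-λ-∂} a` of a dendriform conformal algebra. -/
def dendComp {E : Type*} [AddCommGroup E] [Module ℂ E] [Module ℂ[X] E]
    (D : DendriformConfAlg E) (lam : ℂ) (a b : E) : E :=
  D.succ.mul lam a b - D.prec.mulNeg lam b a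

/-- A conformal NS-algebra. -/
structure NSConfAlg (E : Type*)
    [AddCommGroup E] [Module ℂ E] [Module ℂ[X] E] where
  succ : ConfBilin E E E
  prec : ConfBilin E E E
  vee : ConfBilin E E E
  ns1 : ∀ (lam mu : ℂ) (x y z : E),
    succ.mul lam x (succ.mul mu y z) =
      succ.mul (lam + mu) (succ.mul lam x y + prec.mul lam x y + vee.mul lam x y) z
  ns2 : ∀ (lam mu : ℂ) (x y z : E),
    prec.mul lam x (succ.mul mu y z + prec.mul mu y z + vee.mul mu y z) =
      prec.mul (lam + mu) (prec.mul lam x y) z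
  ns3 : ∀ (lam mu : ℂ) (x y z : E),
    succ.mul lam x (prec.mul mu y z) = prec.mul (lam + mu) (succ.mul lam x y) z
  ns4 : ∀ (lam mu : ℂ) (x y z : E),
    succ.mul lam x (vee.mul mu y z)
        - vee.mul (lam + mu) (succ.mul lam x y + prec.mul lam x y + vee.mul lam x y) z =
      prec.mul (lam + mu) (vee.mul lam x y) z
        - vee.mul lam x (succ.mul mu y z + prec.mul mu y z + vee.mul mu y z)

/-- `x ×_λ y = x ≻_λ y + x ≺_λ y + x ∨_λ y` in a conformal NS-algebra. -/
def nsTimes {E : Type*} [AddCommGroup E] [Module ℂ E] [Module ℂ[X] E]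
    (NS : NSConfAlg E) (lam : ℂ) (x y : E) : E :=
  NS.succ.mul lam x y + NS.prec.mul lam x y + NS.vee.mul lam x y

theorem cev_add_aux {V : Type*} [AddCommGroup V] [Module ℂ V] (lam : ℂ) (p q : ℕ →₀ V) :
    cev lam (p + q) = cev lam p + cev lam q := by
  unfold cev
  exact Finsupp.sum_add_index' (fun _ => smul_zero _) (fun _ _ _ => smul_add _ _ _)

theorem mul_add_left_aux {A B M : Type*}
    [AddCommGroup A] [Module ℂ A] [Module ℂ[X] A]
    [AddCommGroup B] [Module ℂ B] [Module ℂ[X] B]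
    [AddCommGroup M] [Module ℂ M] [Module ℂ[X] M]
    (f : ConfBilin A B M) (lam : ℂ) (a a' : A) (b : B) :
    f.mul lam (a + a') b = f.mul lam a b + f.mul lam a' b := by
  unfold ConfBilin.mul
  rw [f.add_left, cev_add_aux]

theorem mul_add_right_aux {A B M : Type*}
    [AddCommGroup A] [Module ℂ A] [Module ℂ[X] A]
    [AddCommGroup B] [Module ℂ B] [Module ℂ[X] B]
    [AddCommGroup M] [Module ℂ M] [Module ℂ[X] M]
    (f : ConfBilin A B M) (lam : ℂ) (a : A) (b b' : B) :
    f.mul lam a (b + b') = f.mul lam a b + f.mul lam a b' := by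
  unfold ConfBilin.mul
  rw [f.add_right, cev_add_aux]

/-- if `T₁, T₂` are bijective `𝒪`-operators, then `T₁ + T₂` is an
`𝒪`-operator (i.e. `T₁, T₂` are compatible) iff `N = T₁ ∘ T₂⁻¹` is a Nijenhuis
operator on `A`. -/
theorem stmt19 {A M : Type*}
    [AddCommGroup A] [Module ℂ A] [Module ℂ[X] A] [IsScalarTower ℂ ℂ[X] A]
    [AddCommGroup M] [Module ℂ M] [Module ℂ[X] M] [IsScalarTower ℂ ℂ[X] M]
    (θ : AssocConfAlg A) (ρ : ConfBimod θ M) (T₁ T₂ : M ≃ₗ[ℂ[X]] A)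
    (h1 : IsOOperator ρ ⇑T₁) (h2 : IsOOperator ρ ⇑T₂) :
    IsOOperator ρ (fun m => T₁ m + T₂ m) ↔
      IsNijenhuis θ (fun a => T₁ (T₂.symm a)) := by
  have key : ∀ (lam : ℂ) (m n : M),
      (θ.mul lam (T₁ m + T₂ m) (T₁ n + T₂ n) =
        T₁ (ρ.l.mul lam (T₁ m + T₂ m) n + ρ.r.mul lam m (T₁ n + T₂ n)) +
        T₂ (ρ.l.mul lam (T₁ m + T₂ m) n + ρ.r.mul lam m (T₁ n + T₂ n))) ↔
      (θ.mul lam (T₁ m) (T₁ n) =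
        T₁ (T₂.symm (θ.mul lam (T₁ m) (T₂ n) + θ.mul lam (T₂ m) (T₁ n)
          - T₁ (T₂.symm (θ.mul lam (T₂ m) (T₂ n)))))) := by
    intro lam m n
    have e1 := h1 lam m n
    have e2 := h2 lam m n
    have hexp : θ.mul lam (T₁ m + T₂ m) (T₁ n + T₂ n) =
        θ.mul lam (T₁ m) (T₁ n) + θ.mul lam (T₂ m) (T₁ n)
          + (θ.mul lam (T₁ m) (T₂ n) + θ.mul lam (T₂ m) (T₂ n)) := by
      unfold AssocConfAlg.mul
      rw [mul_add_right_aux, mul_add_left_aux, mul_add_left_aux]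
    rw [hexp, e1, e2, mul_add_left_aux, mul_add_right_aux, LinearEquiv.symm_apply_apply,
      T₁.injective.eq_iff, LinearEquiv.eq_symm_apply]
    simp only [map_add]
    constructor
    · intro h
      rw [← sub_eq_zero] at h ⊢
      rw [← neg_eq_zero, ← h]
      abel
    · intro h
      rw [← sub_eq_zero] at h ⊢
      rw [← neg_eq_zero, ← h]
      abel
  constructor
  · intro h lam a b
    have := (key lam (T₂.symm a) (T₂.symm b)).1 (h lam _ _)
    simpa only [LinearEquiv.apply_symm_apply] using this
  · intro h lam m n
    refine (key lam m n).2 ?_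
    have := h lam (T₂ m) (T₂ n)
    simpa only [LinearEquiv.symm_apply_apply] using this
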